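/- Let G be a finite connected distance-hereditary graph. (i) If diam(G) < 2·rad(G), then for every vertex v and every u ∈ F(v) there is a vertex w ∈ I(v,u) ∩ C(G) with u ∈ F(w). (ii) For every vertex v ∉ C(G) and every u ∈ F(v), there is a vertex w ∈ I(v,u) ∩ C¹(G) with u ∈ F(w). -/

import Mathlib

/-- A graph is distance-hereditary if every connected induced subgraph is isometric
(equivalently, every induced path is a shortest path). -/
def DistHereditary {V : Type*} (G : SimpleGraph V) : Prop :=
  ∀ s : Set V, (G.induce s).Connected →
    ∀ u v : s, (G.induce s).dist u v = G.dist (u : V) (v : V)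

/-- Eccentricity of a vertex: `e(v) = max_{u} d(v,u)`. -/
noncomputable def ecc {V : Type*} [Fintype V] (G : SimpleGraph V) (v : V) : ℕ :=
  Finset.univ.sup (fun u => G.dist v u)

/-- Radius: minimum eccentricity. -/
noncomputable def rad {V : Type*} [Fintype V] (G : SimpleGraph V) : ℕ :=
  sInf (Set.range (ecc G))

/-- Diameter: maximum eccentricity. -/
noncomputable def diam {V : Type*} [Fintype V] (G : SimpleGraph V) : ℕ :=
  Finset.univ.sup (fun v => ecc G v)

/-- The center: vertices of minimum eccentricity. -/
def center {V : Type*} [Fintype V] (G : SimpleGraph V) : Set V :=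
  {v | ecc G v = rad G}

/-- Distance from a vertex to a set of vertices: `d(v,S) = min_{s ∈ S} d(v,s)`. -/
noncomputable def distToSet {V : Type*} (G : SimpleGraph V) (v : V) (S : Set V) : ℕ :=
  sInf ((G.dist v) '' S)

/-- The interval `I(x,y)`: vertices on shortest `(x,y)`-paths. -/
def interval {V : Type*} (G : SimpleGraph V) (x y : V) : Set V :=
  {v | G.dist x v + G.dist v y = G.dist x y}

/-- The intervalSlice `S_k(x,y) = {v ∈ I(x,y) : d(x,v) = k}`. -/
def intervalSlice {V : Type*} (G : SimpleGraph V) (x y : V) (k : ℕ) : Set V :=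
  {v | v ∈ interval G x y ∧ G.dist x v = k}

/-- The set `S` induces a cograph in `G`: no induced path on four vertices within `S`. -/
def IsCographOn {V : Type*} (G : SimpleGraph V) (S : Set V) : Prop :=
  ¬ ∃ a b c d : V, a ∈ S ∧ b ∈ S ∧ c ∈ S ∧ d ∈ S ∧
    a ≠ c ∧ a ≠ d ∧ b ≠ d ∧
    G.Adj a b ∧ G.Adj b c ∧ G.Adj c d ∧ ¬ G.Adj a c ∧ ¬ G.Adj a d ∧ ¬ G.Adj b d

namespace SimpleGraph

variable {V : Type*} {G : SimpleGraph V}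

/-- A vertex at any prescribed distance along a shortest path. -/
lemma Connected.exists_dist_eq_of_le_dist (hG : G.Connected) {a b : V} {i : ℕ}
    (hi : i ≤ G.dist a b) : ∃ c, G.dist a c = i ∧ i + G.dist c b = G.dist a b := by
  obtain ⟨p, hp⟩ := hG.exists_walk_length_eq_dist a b
  have h₁ := dist_le (p.take i)
  have h₂ := dist_le (p.drop i)
  rw [Walk.take_length] at h₁
  rw [Walk.drop_length] at h₂
  have h₃ := hG.dist_triangle (u := a) (v := p.getVert i) (w := b)
  exact ⟨p.getVert i, by omega, by omega⟩

lemma Walk.mem_interval_of_mem_support (hG : G.Connected) {a b c : V} {p : G.Walk a b}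
    (hp : p.length = G.dist a b) (hc : c ∈ p.support) : c ∈ interval G a b := by
  classical
  have h₁ := dist_le (p.takeUntil c hc)
  have h₂ := dist_le (p.dropUntil c hc)
  have h₃ := congrArg Walk.length (p.take_spec hc)
  rw [Walk.length_append] at h₃
  have h₄ := hG.dist_triangle (u := a) (v := c) (w := b)
  simp only [interval, Set.mem_ofPred_eq]
  omega

/-- A shortest path from `A` to `B` inside a graph covered by `A` and `B` passes directly
from a vertex of `A` to a vertex of `B`. -/
lemma Connected.exists_crossing_of_cover (hG : G.Connected) {A B : Set V}
    (hAB : ∀ y, y ∈ A ∨ y ∈ B) {v x : V} (hv : v ∈ A) (hx : x ∈ B) :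
    ∃ a ∈ A, ∃ b ∈ B, G.dist a b ≤ 1 ∧
      G.dist v a + G.dist a b + G.dist b x = G.dist v x := by
  induction hn : G.dist v x generalizing v with
  | zero =>
    obtain rfl := hG.dist_eq_zero_iff.mp hn
    exact ⟨v, hv, v, hx, by simp, by simp⟩
  | succ n ih =>
    obtain ⟨c, hvc, hcx⟩ := hG.exists_dist_eq_of_le_dist (a := v) (b := x) (i := 1) (by omega)
    rcases hAB c with hc | hc
    · obtain ⟨a, ha, b, hb, hab, hsum⟩ := ih hc (by omega)
      have h₁ := hG.dist_triangle (u := v) (v := c) (w := a)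
      have h₂ := hG.dist_triangle (u := v) (v := a) (w := x)
      have h₃ := hG.dist_triangle (u := a) (v := b) (w := x)
      exact ⟨a, ha, b, hb, hab, by omega⟩
    · exact ⟨v, hv, c, hc, by omega, by rw [dist_self]; omega⟩

end SimpleGraph

namespace DistHereditary

open SimpleGraph

variable {V : Type*} {G : SimpleGraph V}

lemma exists_crossing_of_walks (hdh : DistHereditary G) {v w x : V} (p : G.Walk v w)
    (q : G.Walk w x) : ∃ a ∈ p.support, ∃ b ∈ q.support, G.dist a b ≤ 1 ∧
      G.dist v a + G.dist a b + G.dist b x = G.dist v x := by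
  have hs : (G.induce ({y | y ∈ p.support} ∪ {y | y ∈ q.support})).Connected :=
    induce_union_connected p.connected_induce_support.preconnected
      q.connected_induce_support.preconnected ⟨w, p.end_mem_support, q.start_mem_support⟩
  have hcross := hs.exists_crossing_of_cover
    (A := {y | (y : V) ∈ p.support}) (B := {y | (y : V) ∈ q.support}) (fun y => y.2)
    (v := ⟨v, Or.inl p.start_mem_support⟩) (x := ⟨x, Or.inr q.end_mem_support⟩)
    p.start_mem_support q.end_mem_support
  simp only [hdh _ hs] at hcross
  obtain ⟨a, ha, b, hb, h⟩ := hcross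
  exact ⟨a, ha, b, hb, h⟩

/-- Some shortest `(v, x)`-path passes directly from given shortest paths `v, y, w` to given
shortest paths `w, y', x`. -/
lemma exists_crossing (hG : G.Connected) (hdh : DistHereditary G) (v y w y' x : V) :
    ∃ a b, (a ∈ interval G v y ∨ a ∈ interval G y w) ∧
      (b ∈ interval G w y' ∨ b ∈ interval G y' x) ∧ G.dist a b ≤ 1 ∧
      G.dist v a + G.dist a b + G.dist b x = G.dist v x := by
  obtain ⟨p₁, hp₁⟩ := hG.exists_walk_length_eq_dist v y
  obtain ⟨p₂, hp₂⟩ := hG.exists_walk_length_eq_dist y w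
  obtain ⟨q₁, hq₁⟩ := hG.exists_walk_length_eq_dist w y'
  obtain ⟨q₂, hq₂⟩ := hG.exists_walk_length_eq_dist y' x
  obtain ⟨a, ha, b, hb, h⟩ := hdh.exists_crossing_of_walks (p₁.append p₂) (q₁.append q₂)
  rw [Walk.mem_support_append_iff] at ha hb
  exact ⟨a, b,
    ha.imp (Walk.mem_interval_of_mem_support hG hp₁) (Walk.mem_interval_of_mem_support hG hp₂),
    hb.imp (Walk.mem_interval_of_mem_support hG hq₁) (Walk.mem_interval_of_mem_support hG hq₂), h⟩

/-- Consecutive slices of an interval are completely joined. -/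
lemma dist_eq_one_of_mem_interval (hG : G.Connected) (hdh : DistHereditary G) {v u w z : V}
    (hw : w ∈ interval G v u) (hz : z ∈ interval G v u) (hwz : G.dist w u = G.dist z u + 1) :
    G.dist w z = 1 := by
  obtain ⟨a, b, ha, hb, hab, hsum⟩ := hdh.exists_crossing hG u z v v w
  simp only [interval, Set.mem_ofPred_eq, dist_self] at *
  have tri (p q r : V) : G.dist p r ≤ G.dist p q + G.dist q r := hG.dist_triangle
  have com (p q : V) : G.dist p q = G.dist q p := dist_comm
  have hbw : G.dist b w = 0 := by
    have := tri v b u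
    have := tri b a u
    have := com u a
    have := com a b
    have := com u w
    rcases hb with hb | hb
    · obtain rfl := hG.dist_eq_zero_iff.mp (show G.dist v b = 0 by omega)
      omega
    · omega
  obtain rfl := hG.dist_eq_zero_iff.mp hbw
  have := tri v a u
  have := com u a
  have := com u b
  have := com u z
  have := com v a
  have := com v z
  rcases ha with ha | ha
  · have haz : G.dist a z = 0 := by omega
    obtain rfl := hG.dist_eq_zero_iff.mp haz
    have := com a b
    omega
  · by_cases h0 : G.dist a b = 0
    · obtain rfl := hG.dist_eq_zero_iff.mp h0
      have := com a z
      omega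
    · have haz : G.dist z a = 0 := by omega
      obtain rfl := hG.dist_eq_zero_iff.mp haz
      have := com z b
      omega

/-- Either `w` is no further from `x` than from `u`, or some shortest `(u, x)`-path runs through
the slice of `I(v, u)` next to `w`. -/
lemma dist_le_or_exists_mem_interval (hG : G.Connected) (hdh : DistHereditary G) {v u w x : V}
    (hw : w ∈ interval G v u) (hwu : 1 ≤ G.dist w u) (hx : G.dist v x ≤ G.dist v u) :
    G.dist w x ≤ G.dist w u ∨ ∃ z ∈ interval G v u, G.dist w z = 1 ∧
      G.dist w u = G.dist z u + 1 ∧ G.dist u z + G.dist z x = G.dist u x := by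
  obtain ⟨a, b, ha, hb, hab, hsum⟩ := hdh.exists_crossing hG v x x x u
  have tri (p q r : V) : G.dist p r ≤ G.dist p q + G.dist q r := hG.dist_triangle
  have com (p q : V) : G.dist p q = G.dist q p := dist_comm
  have hax : G.dist v a + G.dist a x = G.dist v x := by
    rcases ha with ha | ha
    · exact ha
    · simp only [interval, Set.mem_ofPred_eq, dist_self] at ha
      obtain rfl := hG.dist_eq_zero_iff.mp (show G.dist x a = 0 by omega)
      simp
  have hbx : G.dist x b + G.dist b u = G.dist x u := by
    rcases hb with hb | hb
    · simp only [interval, Set.mem_ofPred_eq, dist_self] at hb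
      obtain rfl := hG.dist_eq_zero_iff.mp (show G.dist x b = 0 by omega)
      simp
    · exact hb
  have hw' : G.dist v w + G.dist w u = G.dist v u := hw
  have h₁ := tri a b u
  have h₂ := tri v a u
  by_cases h : G.dist a u < G.dist w u
  · left
    obtain ⟨z, hvz, hza⟩ := hG.exists_dist_eq_of_le_dist (a := v) (b := a)
      (i := G.dist v w + 1) (by omega)
    have h₃ := tri v z u
    have h₄ := tri z a u
    have h₅ := tri z a x
    have hz : z ∈ interval G v u := by
      simp only [interval, Set.mem_ofPred_eq]
      omega
    have h₆ := hdh.dist_eq_one_of_mem_interval hG hw hz (by omega)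
    have h₇ := tri w z x
    omega
  · right
    obtain ⟨z, hbz, hzu⟩ := hG.exists_dist_eq_of_le_dist (a := b) (b := u)
      (i := G.dist b u + 1 - G.dist w u) (by omega)
    have h₃ := tri v a b
    have h₄ := tri v b z
    have h₅ := tri v z u
    have h₆ := tri x b z
    have h₇ := tri x z u
    have h₈ := com u z
    have h₉ := com z x
    have h₁₀ := com u x
    have hz : z ∈ interval G v u := by
      simp only [interval, Set.mem_ofPred_eq]
      omega
    exact ⟨z, hz, hdh.dist_eq_one_of_mem_interval hG hw hz (by omega), by omega, by omega⟩

/-- A vertex `w` of `I(v, u)` that is too far from `x` can be replaced by a vertex of the same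
slice that is close to `x`. -/
lemma exists_mem_interval_dist_add_one_le (hG : G.Connected) (hdh : DistHereditary G)
    {v u w x z : V} {r : ℕ} (hw : w ∈ interval G v u) (hwu : G.dist w u = r)
    (hvx : G.dist v x ≤ G.dist v u) (hwx : r + 1 ≤ G.dist w x)
    (hz : z ∈ interval G v u) (hwz : G.dist w z = 1) (hzu : G.dist w u = G.dist z u + 1)
    (hzx : G.dist z x = r) (hux : G.dist u x + 1 = 2 * r) :
    ∃ y ∈ interval G v u, G.dist y u = r ∧ G.dist y x + 1 ≤ r := by
  obtain ⟨a, b, ha, hb, hab, hsum⟩ := hdh.exists_crossing hG v w z z x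
  have tri (p q r : V) : G.dist p r ≤ G.dist p q + G.dist q r := hG.dist_triangle
  have com (p q : V) : G.dist p q = G.dist q p := dist_comm
  simp only [interval, Set.mem_ofPred_eq] at ha hb hw hz ⊢
  have hbx : G.dist z b + G.dist b x = G.dist z x := by
    rcases hb with hb | hb
    · rw [dist_self] at hb
      obtain rfl := hG.dist_eq_zero_iff.mp (show G.dist z b = 0 by omega)
      simp
    · exact hb
  have haw : G.dist v a + G.dist a w = G.dist v w := by
    rcases ha with ha | ha
    · exact ha
    · by_cases h0 : G.dist w a = 0
      · obtain rfl := hG.dist_eq_zero_iff.mp h0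
        simp
      · obtain rfl := hG.dist_eq_zero_iff.mp (show G.dist a z = 0 by omega)
        have := tri a b x
        omega
  have h₁ := tri a b u
  have h₂ := tri b z u
  have h₃ := tri u b x
  have h₄ := tri w a x
  have h₅ := tri a b x
  have h₆ := com w a
  have h₇ := com b z
  have h₈ := com u b
  have h₉ := tri v a b
  have h₁₀ := tri v a u
  obtain ⟨y, hby, hyu⟩ := hG.exists_dist_eq_of_le_dist (a := b) (b := u)
    (i := G.dist b u - r) (by omega)
  have h₁₁ := tri v b y
  have h₁₂ := tri v y u
  have h₁₃ := tri y b x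
  have h₁₄ := com y b
  exact ⟨y, by omega, by omega, by omega⟩

/-- Two vertices `w`, `w'` with a common neighbour `z` cannot be separated by `x`, `x'` that are
close to each other. -/
lemma two_mul_le_dist (hG : G.Connected) (hdh : DistHereditary G) {w w' z x x' : V} {r : ℕ}
    (hwz : G.dist w z = 1) (hwz' : G.dist w' z = 1) (hzx : r ≤ G.dist z x)
    (hzx' : r ≤ G.dist z x') (hwx : r + 1 ≤ G.dist w x) (hwx' : G.dist w x' ≤ r)
    (hw'x : G.dist w' x + 1 ≤ r) (hw'x' : r + 1 ≤ G.dist w' x') :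
    2 * r ≤ G.dist x' x := by
  obtain ⟨a, b, ha, hb, hab, hsum⟩ := hdh.exists_crossing hG x' w z w' x
  have tri (p q r : V) : G.dist p r ≤ G.dist p q + G.dist q r := hG.dist_triangle
  have com (p q : V) : G.dist p q = G.dist q p := dist_comm
  simp only [interval, Set.mem_ofPred_eq] at ha hb
  have hzz := com x' z
  have hw'z := com w' z
  by_cases haz : a = z
  · subst haz
    have := tri a b x
    omega
  by_cases hbz : b = z
  · subst hbz
    have := tri x' a b
    omega
  have haw : G.dist x' a + G.dist a w = G.dist x' w := by
    rcases ha with ha | ha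
    · exact ha
    · have := hG.pos_dist_of_ne haz
      obtain rfl := hG.dist_eq_zero_iff.mp (show G.dist w a = 0 by omega)
      simp
  have hbw : G.dist w' b + G.dist b x = G.dist w' x := by
    rcases hb with hb | hb
    · have := hG.pos_dist_of_ne (Ne.symm hbz)
      obtain rfl := hG.dist_eq_zero_iff.mp (show G.dist b w' = 0 by omega)
      simp
    · exact hb
  have h₁ := tri w a x
  have h₂ := tri a b x
  have h₃ := tri w' b x'
  have h₄ := tri b a x'
  have h₅ := com w a
  have h₆ := com a x'
  have h₇ := com b a
  have h₈ := com w x'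
  omega

end DistHereditary

section Eccentricity

variable {V : Type*} [Fintype V] (G : SimpleGraph V)

lemma dist_le_ecc (v u : V) : G.dist v u ≤ ecc G v :=
  Finset.le_sup (f := fun u => G.dist v u) (Finset.mem_univ u)

lemma ecc_le {v : V} {n : ℕ} (h : ∀ u, G.dist v u ≤ n) : ecc G v ≤ n :=
  Finset.sup_le fun u _ => h u

lemma dist_le_diam (v u : V) : G.dist v u ≤ diam G :=
  (dist_le_ecc G v u).trans (Finset.le_sup (f := ecc G) (Finset.mem_univ v))

lemma rad_le_ecc (v : V) : rad G ≤ ecc G v :=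
  Nat.sInf_le ⟨v, rfl⟩

lemma exists_ecc_eq_rad [Nonempty V] : ∃ c, ecc G c = rad G :=
  Nat.sInf_mem (Set.range_nonempty (ecc G))

lemma dist_le_two_mul_rad (hG : G.Connected) (u x : V) : G.dist u x ≤ 2 * rad G := by
  have := hG.nonempty
  obtain ⟨c, hc⟩ := exists_ecc_eq_rad G
  have h₁ := hG.dist_triangle (u := u) (v := c) (w := x)
  have h₂ := dist_le_ecc G c u
  have h₃ := dist_le_ecc G c x
  rw [SimpleGraph.dist_comm] at h₂
  omega

end Eccentricity

/-- In a finite connected distance-hereditary graph: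
(i) if `diam(G) < 2·rad(G)` then for every `v` and every `u ∈ F(v)` there is
`w ∈ I(v,u) ∩ C(G)` with `u ∈ F(w)`;
(ii) for every `v ∉ C(G)` and every `u ∈ F(v)` there is `w ∈ I(v,u) ∩ C¹(G)` with `u ∈ F(w)`. -/
theorem path_to_furthest_meets_center {V : Type*} [Fintype V] (G : SimpleGraph V)
    (hconn : G.Connected) (hdh : DistHereditary G) :
    (diam G < 2 * rad G →
      ∀ v u : V, G.dist v u = ecc G v →
        ∃ w : V, w ∈ interval G v u ∧ w ∈ center G ∧ G.dist w u = ecc G w) ∧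
    (∀ v u : V, v ∉ center G → G.dist v u = ecc G v →
        ∃ w : V, w ∈ interval G v u ∧ ecc G w ≤ rad G + 1 ∧ G.dist w u = ecc G w) := by
  classical
  refine ⟨fun hdiam v u hvu => ?_, fun v u hv hvu => ?_⟩
  · have hvx (x : V) : G.dist v x ≤ G.dist v u := hvu ▸ dist_le_ecc G v x
    have hrv := rad_le_ecc G v
    let S : Finset V := {w | w ∈ interval G v u ∧ G.dist w u = rad G}
    let bad (w : V) : Finset V := {x | rad G + 1 ≤ G.dist w x}
    have hS : S.Nonempty := by
      obtain ⟨w, hvw, hwu⟩ := hconn.exists_dist_eq_of_le_dist (a := v) (b := u)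
        (i := G.dist v u - rad G) (by omega)
      refine ⟨w, Finset.mem_filter.mpr ⟨Finset.mem_univ w, ?_, by omega⟩⟩
      simp only [interval, Set.mem_ofPred_eq]
      omega
    obtain ⟨w, hwS, hmin⟩ := S.exists_min_image (fun w => (bad w).card) hS
    obtain ⟨hw, hwu⟩ := (Finset.mem_filter.mp hwS).2
    have key {w x : V} (hw : w ∈ interval G v u) (hwu : G.dist w u = rad G)
        (hwx : rad G + 1 ≤ G.dist w x) : ∃ z ∈ interval G v u, G.dist w z = 1 ∧
          G.dist w u = G.dist z u + 1 ∧ G.dist z x = rad G ∧ G.dist u x + 1 = 2 * rad G := by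
      have hux := dist_le_diam G u x
      rcases hdh.dist_le_or_exists_mem_interval hconn hw (by omega) (hvx x) with h | h
      · omega
      · obtain ⟨z, hz, hwz, hzu, hzx⟩ := h
        have h₁ := hconn.dist_triangle (u := w) (v := z) (w := x)
        have h₂ := G.dist_comm (u := u) (v := z)
        exact ⟨z, hz, hwz, hzu, by omega, by omega⟩
    have hgood : bad w = ∅ := by
      by_contra hne
      obtain ⟨x, hx⟩ := Finset.nonempty_iff_ne_empty.mpr hne
      have hwx : rad G + 1 ≤ G.dist w x := (Finset.mem_filter.mp hx).2
      obtain ⟨z, hz, hwz, hzu, hzx, hux⟩ := key hw hwu hwx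
      obtain ⟨y, hy, hyu, hyx⟩ := hdh.exists_mem_interval_dist_add_one_le hconn hw hwu (hvx x)
        hwx hz hwz hzu hzx hux
      have hyS : y ∈ S := Finset.mem_filter.mpr ⟨Finset.mem_univ y, hy, hyu⟩
      obtain ⟨x', hx'y, hx'w⟩ : ∃ x' ∈ bad y, x' ∉ bad w := by
        by_contra! hsub
        refine (hmin y hyS).not_gt (Finset.card_lt_card ⟨hsub, fun hle => ?_⟩)
        have := (Finset.mem_filter.mp (hle hx)).2
        omega
      have hyx' : rad G + 1 ≤ G.dist y x' := (Finset.mem_filter.mp hx'y).2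
      have hwx' : G.dist w x' ≤ rad G := by
        simpa [bad, Nat.lt_succ_iff] using hx'w
      obtain ⟨-, -, -, -, -, hux'⟩ := key hy hyu hyx'
      have h₁ := hconn.dist_triangle (u := u) (v := z) (w := x')
      have h₂ := G.dist_comm (u := u) (v := z)
      have h₃ := hdh.two_mul_le_dist hconn hwz
        (hdh.dist_eq_one_of_mem_interval hconn hy hz (by omega)) hzx.ge (by omega) hwx hwx' hyx hyx'
      have h₄ := dist_le_diam G x' x
      omega
    have hecc : ecc G w ≤ rad G := ecc_le G fun x => by
      by_contra hx
      have : x ∈ bad w := Finset.mem_filter.mpr ⟨Finset.mem_univ x, by omega⟩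
      simp [hgood] at this
    have hwr : ecc G w = rad G := hecc.antisymm (rad_le_ecc G w)
    exact ⟨w, hw, hwr, hwu.trans hwr.symm⟩
  · have hrv : rad G < ecc G v := lt_of_le_of_ne (rad_le_ecc G v) (Ne.symm hv)
    obtain ⟨w, hvw, hwu⟩ := hconn.exists_dist_eq_of_le_dist (a := v) (b := u)
      (i := G.dist v u - (rad G + 1)) (by omega)
    have hw : w ∈ interval G v u := by
      simp only [interval, Set.mem_ofPred_eq]
      omega
    have hecc : ecc G w ≤ rad G + 1 := ecc_le G fun x => by
      rcases hdh.dist_le_or_exists_mem_interval hconn hw (by omega)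
        (hvu ▸ dist_le_ecc G v x) with h | ⟨z, hz, hwz, hzu, hzx⟩
      · omega
      · have h₁ := dist_le_two_mul_rad G hconn u x
        have h₂ := hconn.dist_triangle (u := w) (v := z) (w := x)
        have h₃ := G.dist_comm (u := u) (v := z)
        omega
    have h := dist_le_ecc G w u
    exact ⟨w, hw, hecc, by omega⟩
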